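/- arXiv:1311.6292 — 2 statements merged into one kernel-verified Lean document; each statement's English description precedes it below -/
import Mathlib

section
/- For all integers n ≥ 1 and 0 ≤ k ≤ n−1, the number of 132-avoiding permutations σ of {1,…,n} with mmp(1,0,0,0)(σ) = k equals the Catalan triangle number C(n,k) = ((n−k)/n)·binomial(n+k−1, k). -/
/-- A permutation `σ` of `{1,…,n}` (as a permutation of `Fin n`) avoids the pattern 132 if
there are no indices `i < j < k` with `σ i < σ k < σ j`. -/
def Avoids132 (n : ℕ) (σ : Equiv.Perm (Fin n)) : Prop :=
  ∀ i j k : Fin n, i < j → j < k → ¬(σ i < σ k ∧ σ k < σ j)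

/-- `mmp n a b c d σ` is the number of indices `i` matching the marked mesh pattern
`MMP(a,b,c,d)` in `σ`: there are at least `a` indices `j > i` with `σ j > σ i`,
at least `b` indices `j < i` with `σ j > σ i`, at least `c` indices `j < i` with
`σ j < σ i`, and at least `d` indices `j > i` with `σ j < σ i`. -/
noncomputable def mmp (n a b c d : ℕ) (σ : Equiv.Perm (Fin n)) : ℕ :=
  Nat.card {i : Fin n |
    a ≤ Nat.card {j : Fin n | i < j ∧ σ i < σ j} ∧
    b ≤ Nat.card {j : Fin n | j < i ∧ σ i < σ j} ∧
    c ≤ Nat.card {j : Fin n | j < i ∧ σ j < σ i} ∧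
    d ≤ Nat.card {j : Fin n | i < j ∧ σ j < σ i}}

open Finset Classical in
/-- The right-to-left maxima of a permutation. -/
noncomputable def rlMax (n : ℕ) (σ : Equiv.Perm (Fin n)) : Finset (Fin n) :=
  univ.filter (fun i => ∀ j, i < j → σ j < σ i)

/-- Append a new last value `v` to the permutation `τ`. -/
def insLast (n : ℕ) (v : Fin (n + 1)) (τ : Equiv.Perm (Fin n)) : Equiv.Perm (Fin (n + 1)) :=
  (finSuccEquivLast.trans (Equiv.optionCongr τ)).trans (finSuccEquiv' v).symm

lemma insLast_last (n : ℕ) (v : Fin (n + 1)) (τ : Equiv.Perm (Fin n)) :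
    insLast n v τ (Fin.last n) = v := by
  simp [insLast]

lemma insLast_castSucc (n : ℕ) (v : Fin (n + 1)) (τ : Equiv.Perm (Fin n)) (i : Fin n) :
    insLast n v τ i.castSucc = v.succAbove (τ i) := by
  simp [insLast]

lemma insLast_bij (n : ℕ) :
    Function.Bijective (fun p : Equiv.Perm (Fin n) × Fin (n + 1) => insLast n p.2 p.1) := by
  rw [Fintype.bijective_iff_injective_and_card]
  constructor
  · rintro ⟨τ, v⟩ ⟨τ', v'⟩ h
    simp only at h
    have hv : v = v' := by
      rw [← insLast_last n v τ, ← insLast_last n v' τ', h]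
    subst hv
    have : τ = τ' := by
      ext i
      have := insLast_castSucc n v τ i
      rw [h, insLast_castSucc] at this
      rw [Fin.succAbove_right_injective this]
    rw [this]
  · simp [Fintype.card_perm, Nat.factorial_succ, mul_comm]

lemma succAbove_lt_self_iff {n : ℕ} (v : Fin (n + 1)) (a : Fin n) :
    v.succAbove a < v ↔ (a : ℕ) < v := by
  rw [Fin.succAbove_lt_iff_castSucc_lt]; rfl

lemma self_lt_succAbove_iff {n : ℕ} (v : Fin (n + 1)) (a : Fin n) :
    v < v.succAbove a ↔ (v : ℕ) ≤ a := by
  rw [Fin.lt_succAbove_iff_le_castSucc]; rfl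

lemma avoids_insLast (n : ℕ) (v : Fin (n + 1)) (τ : Equiv.Perm (Fin n)) :
    Avoids132 (n + 1) (insLast n v τ) ↔
      Avoids132 n τ ∧ ∀ i j : Fin n, i < j → ¬ ((τ i : ℕ) < v ∧ (v : ℕ) ≤ τ j) := by
  constructor
  · intro h
    constructor
    · intro i j k hij hjk
      have := h i.castSucc j.castSucc k.castSucc (by simpa using hij) (by simpa using hjk)
      simpa [insLast_castSucc] using this
    · intro i j hij
      have := h i.castSucc j.castSucc (Fin.last n) (by simpa using hij) (Fin.castSucc_lt_last j)
      simpa only [insLast_castSucc, insLast_last, succAbove_lt_self_iff,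
        self_lt_succAbove_iff] using this
  · rintro ⟨h1, h2⟩ i j k hij hjk
    have hj : j ≠ Fin.last n := (lt_of_lt_of_le hjk (Fin.le_last k)).ne
    have hi : i ≠ Fin.last n := (lt_of_lt_of_le hij (Fin.le_last j)).ne
    obtain ⟨i, rfl⟩ := Fin.exists_castSucc_eq.2 hi
    obtain ⟨j, rfl⟩ := Fin.exists_castSucc_eq.2 hj
    induction k using Fin.lastCases with
    | last =>
      simp only [insLast_castSucc, insLast_last, succAbove_lt_self_iff, self_lt_succAbove_iff]
      exact h2 i j (by simpa using hij)
    | cast k =>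
      have := h1 i j k (by simpa using hij) (by simpa using hjk)
      simpa [insLast_castSucc] using this

/-- The values of right-to-left maxima. -/
noncomputable def rlVal (n : ℕ) (τ : Equiv.Perm (Fin n)) : Finset ℕ :=
  (rlMax n τ).image (fun i => (τ i : ℕ))

lemma rlVal_card (n : ℕ) (τ : Equiv.Perm (Fin n)) : (rlVal n τ).card = (rlMax n τ).card := by
  apply Finset.card_image_of_injective
  intro a b h
  exact τ.injective (Fin.ext h)

lemma rlMax_insLast (n : ℕ) (v : Fin (n + 1)) (τ : Equiv.Perm (Fin n)) :
    (rlMax (n + 1) (insLast n v τ)).card =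
      ((rlVal n τ).filter (fun s => (v : ℕ) ≤ s)).card + 1 := by
  classical
  have h : rlMax (n + 1) (insLast n v τ) =
      insert (Fin.last n) (((rlMax n τ).filter (fun i => (v : ℕ) ≤ τ i)).image Fin.castSucc) := by
    ext i
    induction i using Fin.lastCases with
    | last =>
      simp only [rlMax, Finset.mem_filter, Finset.mem_univ, true_and, Finset.mem_insert, true_or,
        iff_true]
      intro j hj
      exact absurd (Fin.le_last j) (not_le.2 hj)
    | cast i =>
      have hne : i.castSucc ≠ Fin.last n := (Fin.castSucc_lt_last i).ne
      simp only [rlMax, Finset.mem_filter, Finset.mem_univ, true_and, Finset.mem_insert, hne,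
        false_or, Finset.mem_image, Fin.castSucc_inj, exists_eq_right, Fin.forall_fin_succ']
      simp [insLast_castSucc, insLast_last, self_lt_succAbove_iff, Fin.castSucc_lt_last]
  rw [h, Finset.card_insert_of_notMem, Finset.card_image_of_injective _ (Fin.castSucc_injective n),
    rlVal, Finset.filter_image, Finset.card_image_of_injective]
  · intro a b h
    exact τ.injective (Fin.ext h)
  · simp

lemma valid_iff (n : ℕ) (v : Fin (n + 1)) (τ : Equiv.Perm (Fin n)) (h : Avoids132 n τ) :
    (∀ i j : Fin n, i < j → ¬ ((τ i : ℕ) < v ∧ (v : ℕ) ≤ τ j)) ↔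
      (v : ℕ) ∈ insert 0 ((rlVal n τ).image (· + 1)) := by
  simp only [Finset.mem_insert, Finset.mem_image, rlVal, rlMax, Finset.mem_filter,
    Finset.mem_univ, true_and, exists_exists_and_eq_and]
  constructor
  · intro hv
    by_cases h0 : (v : ℕ) = 0
    · exact Or.inl h0
    · right
      have hlt : (v : ℕ) - 1 < n := by omega
      refine ⟨τ.symm ⟨v - 1, hlt⟩, ?_, ?_⟩
      · intro j hj
        by_contra hc
        have := hv _ j hj
        have hne : τ j ≠ ⟨v - 1, hlt⟩ := by
          intro he
          rw [← he] at hj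
          simp at hj
        rw [Equiv.apply_symm_apply] at hc this
        rw [Fin.lt_def] at hc
        rw [Ne, Fin.ext_iff] at hne
        simp only at hc hne this
        omega
      · simp; omega
  · rintro (h0 | ⟨p, hp, hpv⟩) i j hij ⟨h1, h2⟩
    · omega
    · have hjp : j < p := by
        by_contra hc
        rcases eq_or_lt_of_le (not_lt.1 hc) with e | e
        · subst e; omega
        · have := hp j e
          rw [Fin.lt_def] at this; omega
      have hne : (τ i : ℕ) ≠ τ p := by
        intro e
        have := τ.injective (Fin.ext e)
        subst this
        exact absurd hij (not_lt.2 hjp.le)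
      exact h i j p hij hjp ⟨by rw [Fin.lt_def]; omega, by rw [Fin.lt_def]; omega⟩

lemma count_sites (S : Finset ℕ) (m : ℕ) :
    ((insert 0 (S.image (· + 1))).filter
      (fun v => (S.filter (fun s => v ≤ s)).card = m)).card = if m ≤ S.card then 1 else 0 := by
  set V := insert 0 (S.image (· + 1)) with hV
  set f : ℕ → ℕ := fun v => (S.filter (fun s => v ≤ s)).card with hf
  have hlt : ∀ v ∈ V, ∀ v' ∈ V, v < v' → f v' < f v := by
    intro v _ v' hv' hl
    rw [hV, Finset.mem_insert, Finset.mem_image] at hv'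
    rcases hv' with rfl | ⟨s, hs, rfl⟩
    · omega
    · apply Finset.card_lt_card
      rw [Finset.ssubset_iff_of_subset]
      · exact ⟨s, by simp [hs]; omega, by simp⟩
      · intro x; simp only [Finset.mem_filter]; rintro ⟨a, b⟩; exact ⟨a, by omega⟩
  have hinj : Set.InjOn f V := by
    intro a ha b hb hab
    rcases lt_trichotomy a b with h | h | h
    · have := hlt a ha b hb h; omega
    · exact h
    · have := hlt b hb a ha h; omega
  have hVc : V.card = S.card + 1 := by
    rw [hV, Finset.card_insert_of_notMem (by simp),
      Finset.card_image_of_injective _ (add_left_injective 1)]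
  have himg : V.image f = Finset.range (S.card + 1) := by
    apply Finset.eq_of_subset_of_card_le
    · intro x hx
      obtain ⟨v, _, rfl⟩ := Finset.mem_image.1 hx
      rw [Finset.mem_range]
      exact Nat.lt_succ_of_le (Finset.card_filter_le _ _)
    · rw [Finset.card_image_of_injOn hinj, hVc, Finset.card_range]
  split_ifs with hm
  · have : m ∈ V.image f := by rw [himg, Finset.mem_range]; omega
    obtain ⟨v, hv, hvm⟩ := Finset.mem_image.1 this
    rw [Finset.card_eq_one]
    refine ⟨v, ?_⟩
    ext w
    simp only [Finset.mem_filter, Finset.mem_singleton]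
    constructor
    · rintro ⟨hw, hwm⟩
      exact hinj hw hv (hwm.trans hvm.symm)
    · rintro rfl
      exact ⟨hv, hvm⟩
  · rw [Finset.card_eq_zero, Finset.filter_eq_empty_iff]
    intro v _ h
    apply hm
    rw [← h]
    exact Finset.card_filter_le _ _

open Finset Classical in
/-- Number of avoiders with `m` right-to-left maxima. -/
noncomputable def cnt (n m : ℕ) : ℕ :=
  (univ.filter (fun σ : Equiv.Perm (Fin n) => Avoids132 n σ ∧ (rlMax n σ).card = m)).card

lemma rlVal_lt (n : ℕ) (τ : Equiv.Perm (Fin n)) (s : ℕ) (hs : s ∈ rlVal n τ) : s < n := by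
  obtain ⟨i, _, rfl⟩ := Finset.mem_image.1 hs
  exact (τ i).2

open Finset Classical in
lemma cnt_succ (n m : ℕ) : cnt (n + 1) (m + 1) =
    (univ.filter (fun τ : Equiv.Perm (Fin n) => Avoids132 n τ ∧ m ≤ (rlMax n τ).card)).card := by
  rw [cnt, card_filter, card_filter, ← (insLast_bij n).sum_comp, Fintype.sum_prod_type]
  refine sum_congr rfl fun τ _ => ?_
  simp only [avoids_insLast, rlMax_insLast, add_left_inj]
  by_cases h : Avoids132 n τ
  · simp only [h, true_and, valid_iff n _ τ h]
    rw [← rlVal_card, ← count_sites, ← card_filter]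
    rw [← card_image_of_injective _ Fin.val_injective]
    congr 1
    ext v
    simp only [mem_image, mem_filter, mem_univ, true_and]
    constructor
    · rintro ⟨a, ⟨h1, h2⟩, rfl⟩
      exact ⟨h1, h2⟩
    · rintro ⟨h1, h2⟩
      have hv : v < n + 1 := by
        rw [mem_insert, mem_image] at h1
        rcases h1 with rfl | ⟨s, hs, rfl⟩
        · omega
        · have := rlVal_lt n τ s hs
          omega
      exact ⟨⟨v, hv⟩, ⟨h1, h2⟩, rfl⟩
  · simp [h]

open Finset Classical in
lemma cnt_rec (n m : ℕ) : cnt (n + 1) (m + 1) = cnt n m + cnt (n + 1) (m + 2) := by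
  rw [cnt_succ, cnt_succ n (m + 1), cnt, ← card_union_of_disjoint]
  · congr 1
    ext τ
    simp only [mem_filter, mem_univ, true_and, mem_union, ← and_or_left]
    apply and_congr_right
    intro _
    omega
  · rw [disjoint_left]
    intro τ
    simp only [mem_filter, mem_univ, true_and]
    omega

open Finset Classical in
lemma cnt_big (n m : ℕ) (h : n < m) : cnt n m = 0 := by
  rw [cnt, card_eq_zero, filter_eq_empty_iff]
  rintro σ - ⟨_, h2⟩
  have := card_le_univ (rlMax n σ)
  rw [Fintype.card_fin] at this
  omega

open Finset Classical in
lemma cnt_zero (n : ℕ) : cnt (n + 1) 0 = 0 := by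
  rw [cnt, card_eq_zero, filter_eq_empty_iff]
  rintro σ - ⟨_, h2⟩
  obtain ⟨⟨τ, v⟩, rfl⟩ := (insLast_bij n).2 σ
  simp only [rlMax_insLast] at h2
  omega

open Finset Classical in
lemma cnt_zero_zero : cnt 0 0 = 1 := by
  have h : ∀ σ : Equiv.Perm (Fin 0), Avoids132 0 σ ∧ (rlMax 0 σ).card = 0 := by
    intro σ
    refine ⟨fun i => i.elim0, ?_⟩
    have := card_le_univ (rlMax 0 σ)
    simpa using this
  rw [cnt, filter_true_of_mem (fun σ _ => h σ)]
  simp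

lemma cnt_self (n : ℕ) : cnt n n = 1 := by
  induction n with
  | zero => exact cnt_zero_zero
  | succ n ih => rw [cnt_rec, ih, cnt_big _ _ (by omega)]

lemma cnt_formula (n : ℕ) : ∀ k m : ℕ, m + k = n + 1 →
    ((n : ℚ) + 1) * cnt (n + 1) m = (m : ℚ) * ((n + k).choose k : ℕ) := by
  induction n with
  | zero =>
    intro k m h
    rcases m with _ | m
    · simp [cnt_zero]
    · obtain ⟨rfl, rfl⟩ : m = 0 ∧ k = 0 := by omega
      simp [cnt_self]
  | succ n ih =>
    intro k
    induction k with
    | zero =>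
      intro m h
      obtain rfl : m = n + 1 + 1 := by omega
      simp [cnt_self]
    | succ k ihk =>
      intro m h
      rcases m with _ | m
      · simp [cnt_zero]
      · rw [cnt_rec]
        have h1 := ih (k + 1) m (by omega)
        have h2 := ihk (m + 2) (by omega)
        have e1 : n + 1 + (k + 1) = (n + 1 + k) + 1 := by omega
        have e2 : n + (k + 1) = n + 1 + k := by omega
        rw [e2] at h1
        rw [e1, Nat.choose_succ_succ]
        have h3 := Nat.choose_succ_right_eq (n + 1 + k) k
        rw [Nat.add_sub_cancel] at h3
        have h3' : ((n + 1 + k).choose (k + 1) : ℚ) * (k + 1) = (n + 1 + k).choose k * (n + 1) := by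
          exact_mod_cast h3
        have hn : (n : ℚ) = m + k := by
          have : n = m + k := by omega
          exact_mod_cast this
        have hx : ((n + 1 + k).choose (k + 1) : ℚ) =
            (n + 1 + k).choose k * (n + 1) / (k + 1) := by
          rw [eq_div_iff (by positivity)]; exact h3'
        have hn1 : (n : ℚ) + 1 ≠ 0 := by positivity
        have h1' : (cnt (n + 1) m : ℚ) = m * (n + 1 + k).choose (k + 1) / (n + 1) := by
          rw [eq_div_iff hn1, ← h1]; ring
        push_cast at h2 ⊢
        rw [mul_add, h2, h1', hx]
        have hk1 : (k : ℚ) + 1 ≠ 0 := by positivity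
        field_simp
        rw [hn]
        ring

lemma mmp_add_rlMax (n : ℕ) (σ : Equiv.Perm (Fin n)) :
    mmp n 1 0 0 0 σ + (rlMax n σ).card = n := by
  classical
  have h : mmp n 1 0 0 0 σ = (Finset.univ.filter (fun i => ¬ ∀ j, i < j → σ j < σ i)).card := by
    rw [mmp, ← Fintype.card_subtype, ← Nat.card_eq_fintype_card]
    congr 2
    ext i
    simp only [Set.mem_ofPred_eq, Nat.zero_le, and_true]
    rw [Nat.one_le_iff_ne_zero, ← Nat.pos_iff_ne_zero, Nat.card_pos_iff]
    constructor
    · rintro ⟨⟨j, hj1, hj2⟩, _⟩ hc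
      exact absurd (hc j hj1) (not_lt.2 hj2.le)
    · intro hc
      replace hc : ¬ ∀ j, i < j → σ j < σ i := hc
      push Not at hc
      obtain ⟨j, hj, hle⟩ := hc
      refine ⟨⟨j, hj, lt_of_le_of_ne hle ?_⟩, inferInstance⟩
      intro e
      exact hj.ne (σ.injective e)
  rw [h, rlMax, add_comm]
  have := Finset.card_filter_add_card_filter_not (s := (Finset.univ : Finset (Fin n)))
    (fun i => ∀ j, i < j → σ j < σ i)
  rw [Finset.card_univ, Fintype.card_fin] at this
  convert this

/-- The number of 132-avoiding permutations of `{1,…,n}` with `mmp(1,0,0,0)(σ) = k`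
equals the Catalan triangle number `C(n,k) = ((n-k)/n) * choose (n+k-1) k`
(stated multiplied through by `n` to avoid rational arithmetic). -/
theorem card_mmp1000_eq_catalanTriangle (n k : ℕ) (hn : 1 ≤ n) (hk : k ≤ n - 1) :
    n * Nat.card {σ : Equiv.Perm (Fin n) | Avoids132 n σ ∧ mmp n 1 0 0 0 σ = k} =
    (n - k) * (n + k - 1).choose k := by
  classical
  obtain ⟨n, rfl⟩ : ∃ m, n = m + 1 := ⟨n - 1, by omega⟩
  have hc : Nat.card {σ : Equiv.Perm (Fin (n + 1)) | Avoids132 (n + 1) σ ∧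
      mmp (n + 1) 1 0 0 0 σ = k} = cnt (n + 1) (n + 1 - k) := by
    rw [cnt, ← Fintype.card_subtype, ← Nat.card_eq_fintype_card]
    congr 2
    ext σ
    simp only [Set.mem_ofPred_eq]
    apply and_congr_right
    intro _
    have := mmp_add_rlMax (n + 1) σ
    omega
  rw [hc]
  have := cnt_formula n k (n + 1 - k) (by omega)
  have e : n + 1 + k - 1 = n + k := by omega
  rw [e]
  exact_mod_cast this
end

section
/- Let A(n,k) denote the number of 132-avoiding permutations σ of {1,…,n} with mmp(0,k,0,0)(σ) = 0. Then A(n,k) = 1 if n = 1 or k = 1; A(n,k) = A(n−1,k) + A(n,k−1) if 2 ≤ k ≤ n; and A(n,k) = A(n,k−1) if 2 ≤ n < k. -/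
/-- `A n k` is the number of 132-avoiding permutations `σ` of `{1,…,n}` with
`mmp(0,k,0,0)(σ) = 0`. -/
noncomputable def A (n k : ℕ) : ℕ :=
  Nat.card {σ : Equiv.Perm (Fin n) | Avoids132 n σ ∧ mmp n 0 k 0 0 σ = 0}

open Equiv in
theorem incr_after {n : ℕ} {σ : Perm (Fin (n+1))} (h : Avoids132 (n+1) σ) {i j : Fin (n+1)}
    (hi : σ.symm 0 ≤ i) (hij : i < j) : σ i < σ j := by
  rcases hi.eq_or_lt with rfl | hi
  · rw [σ.apply_symm_apply]
    refine Fin.pos_of_ne_zero ?_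
    intro h0
    rw [← h0, σ.symm_apply_apply] at hij
    exact lt_irrefl _ hij
  · have h1 := h _ _ _ hi hij
    rw [σ.apply_symm_apply] at h1
    by_contra h2
    have hne : σ j ≠ σ i := fun e => hij.ne' (σ.injective e)
    have hlt : σ j < σ i := lt_of_le_of_ne (not_lt.mp h2) hne
    refine h1 ⟨Fin.pos_of_ne_zero ?_, hlt⟩
    intro h0
    rw [← h0, σ.symm_apply_apply] at hi
    exact absurd (hi.trans hij) (lt_irrefl _)

open Equiv in
theorem mmp_zero_iff {n k : ℕ} {σ : Perm (Fin (n+1))} (h : Avoids132 (n+1) σ) :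
    mmp (n+1) 0 k 0 0 σ = 0 ↔ (σ.symm 0 : ℕ) < k := by
  unfold mmp
  simp only [Nat.card_coe_set_eq]
  rw [Set.ncard_eq_zero (Set.toFinite _), Set.eq_empty_iff_forall_notMem]
  simp only [Set.mem_ofPred_eq, zero_le, true_and, and_true, not_le]
  have hcard : ∀ p : Fin (n+1), ({j | j < p} : Set (Fin (n+1))).ncard = (p : ℕ) := by
    intro p
    have : ({j | j < p} : Set (Fin (n+1))) = ((Finset.Iio p : Finset (Fin (n+1))) : Set _) := by
      ext; simp
    rw [this, Set.ncard_coe_finset, Fin.card_Iio]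
  constructor
  · intro H
    have := H (σ.symm 0)
    rw [σ.apply_symm_apply] at this
    refine lt_of_le_of_lt ?_ this
    rw [← hcard (σ.symm 0)]
    refine Set.ncard_le_ncard ?_ (Set.toFinite _)
    intro j hj
    refine ⟨hj, Fin.pos_of_ne_zero ?_⟩
    intro h0
    rw [← h0, σ.symm_apply_apply] at hj
    exact lt_irrefl j hj
  · intro H i
    refine lt_of_le_of_lt ?_ H
    rw [← hcard (σ.symm 0)]
    refine Set.ncard_le_ncard ?_ (Set.toFinite _)
    rintro j ⟨hj, hj2⟩
    by_contra hc
    exact absurd (incr_after h (not_lt.mp hc) hj) (not_lt.mpr hj2.le)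

theorem A_eq (n k : ℕ) : A (n+1) k =
    ({σ | Avoids132 (n+1) σ ∧ (σ.symm 0 : ℕ) < k} : Set (Equiv.Perm (Fin (n+1)))).ncard := by
  unfold A
  rw [Nat.card_coe_set_eq]
  congr 1
  ext σ
  simp only [Set.mem_ofPred_eq]
  exact and_congr_right fun h => mmp_zero_iff h

/-- insert the minimum at position `p` -/
def insMin {n : ℕ} (p : Fin (n+1)) (τ : Equiv.Perm (Fin n)) : Equiv.Perm (Fin (n+1)) :=
  ((finSuccEquiv' p).trans (Equiv.optionCongr τ)).trans (finSuccEquiv' 0).symm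

theorem insMin_self {n : ℕ} (p : Fin (n+1)) (τ : Equiv.Perm (Fin n)) : insMin p τ p = 0 := by
  simp [insMin]

theorem insMin_succAbove {n : ℕ} (p : Fin (n+1)) (τ : Equiv.Perm (Fin n)) (j : Fin n) :
    insMin p τ (p.succAbove j) = (τ j).succ := by
  simp [insMin]

theorem insMin_injective {n : ℕ} (p : Fin (n+1)) : Function.Injective (insMin p) := by
  intro τ τ' h
  ext j
  have := insMin_succAbove p τ j
  rw [h, insMin_succAbove] at this
  rw [Fin.succ_injective _ this]

theorem insMin_surj {n : ℕ} (p : Fin (n+1)) (σ : Equiv.Perm (Fin (n+1))) (h : σ p = 0) :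
    ∃ τ, insMin p τ = σ := by
  let ρ : Equiv.Perm (Option (Fin n)) := ((finSuccEquiv' p).symm.trans σ).trans (finSuccEquiv' 0)
  have hρ : ρ none = none := by simp [ρ, h]
  have h2 := map_equiv_removeNone ρ
  rw [hρ, Equiv.swap_self] at h2
  refine ⟨Equiv.removeNone ρ, ?_⟩
  unfold insMin
  rw [h2]
  ext x
  simp [ρ]

theorem insMin_avoids {n : ℕ} (p : Fin (n+2)) (τ : Equiv.Perm (Fin (n+1))) :
    Avoids132 (n+2) (insMin p τ) ↔ Avoids132 (n+1) τ ∧ (τ.symm 0 : ℕ) ≤ p := by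
  have hsa : ∀ {i j : Fin (n+1)}, i < j → p.succAbove i < p.succAbove j :=
    fun h => Fin.strictMono_succAbove p h
  constructor
  · intro h
    constructor
    · intro i j k hij hjk
      have := h _ _ _ (hsa hij) (hsa hjk)
      simpa only [insMin_succAbove, Fin.succ_lt_succ_iff] using this
    · by_contra hc
      rw [not_le] at hc
      have hp : (p : ℕ) < n+1 := lt_trans hc (τ.symm 0).2
      let q : Fin (n+1) := ⟨p, hp⟩
      have hpq : p < p.succAbove q := by
        rw [Fin.lt_succAbove_iff_le_castSucc, Fin.le_def]; simp [q]
      have hq : q < τ.symm 0 := hc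
      have := h _ _ _ hpq (hsa hq)
      simp only [insMin_succAbove, insMin_self, τ.apply_symm_apply, Fin.succ_pos,
        Fin.succ_lt_succ_iff, true_and] at this
      apply this
      refine Fin.pos_of_ne_zero fun h0 => ?_
      rw [← h0, τ.symm_apply_apply] at hq
      exact lt_irrefl _ hq
  · rintro ⟨h, hle⟩ i j k hij hjk ⟨h1, h2⟩
    rcases Fin.eq_self_or_eq_succAbove p k with rfl | ⟨k, rfl⟩
    · rw [insMin_self] at h1; exact absurd h1 (Fin.not_lt_zero _)
    rcases Fin.eq_self_or_eq_succAbove p j with rfl | ⟨j, rfl⟩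
    · rw [insMin_self] at h2; exact absurd h2 (Fin.not_lt_zero _)
    rw [insMin_succAbove, insMin_succAbove, Fin.succ_lt_succ_iff] at h2
    have hjk' := (Fin.strictMono_succAbove p).lt_iff_lt.mp hjk
    rcases Fin.eq_self_or_eq_succAbove p i with rfl | ⟨i, rfl⟩
    · rw [Fin.lt_succAbove_iff_le_castSucc, Fin.le_def] at hij
      have hj : τ.symm 0 ≤ j := Fin.le_def.mpr (le_trans hle hij)
      exact absurd (incr_after h hj hjk') (not_lt.mpr h2.le)
    · rw [insMin_succAbove, insMin_succAbove, Fin.succ_lt_succ_iff] at h1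
      exact h _ _ _ ((Fin.strictMono_succAbove p).lt_iff_lt.mp hij) hjk' ⟨h1, h2⟩

theorem card_exact (n : ℕ) (p : Fin (n+2)) :
    ({σ | Avoids132 (n+2) σ ∧ σ.symm 0 = p} : Set (Equiv.Perm (Fin (n+2)))).ncard
      = A (n+1) (p+1) := by
  rw [A_eq, ← Set.ncard_image_of_injective _ (insMin_injective p)]
  congr 1
  ext σ
  simp only [Set.mem_ofPred_eq, Set.mem_image, Nat.lt_succ_iff]
  constructor
  · rintro ⟨h, rfl⟩
    obtain ⟨τ, hτ⟩ := insMin_surj (σ.symm 0) σ (by simp)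
    refine ⟨τ, ?_, hτ⟩
    rw [← insMin_avoids, hτ]
    exact h
  · rintro ⟨τ, h, rfl⟩
    refine ⟨(insMin_avoids p τ).2 h, ?_⟩
    rw [Equiv.symm_apply_eq, insMin_self]

theorem A_step (n k : ℕ) (hk : k ≤ n + 1) : A (n+2) (k+1) = A (n+1) (k+1) + A (n+2) k := by
  have := card_exact n ⟨k, by omega⟩
  simp only at this
  rw [← this, A_eq, A_eq, ← Set.ncard_union_eq _ (Set.toFinite _) (Set.toFinite _)]
  · congr 1
    ext σ
    simp only [Set.mem_ofPred_eq, Set.mem_union, Fin.ext_iff, ← and_or_left]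
    apply and_congr_right
    intro _
    omega
  · rw [Set.disjoint_left]
    rintro σ ⟨_, h1⟩ ⟨_, h2⟩
    rw [h1] at h2
    exact lt_irrefl _ h2

theorem A_zero (n : ℕ) : A (n+1) 0 = 0 := by
  rw [A_eq]; simp

theorem A_one (k : ℕ) (hk : 1 ≤ k) : A 1 k = 1 := by
  rw [A_eq]
  have : ({σ | Avoids132 1 σ ∧ (σ.symm 0 : ℕ) < k} : Set (Equiv.Perm (Fin 1))) = {1} := by
    ext σ
    simp only [Set.mem_ofPred_eq, Set.mem_singleton_iff]
    refine ⟨fun _ => Subsingleton.elim _ _, fun _ => ⟨?_, by omega⟩⟩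
    intro i j k hij
    omega
  rw [this, Set.ncard_singleton]

/-- `A(n,k) = 1` if `n = 1` or `k = 1`; `A(n,k) = A(n-1,k) + A(n,k-1)` if `2 ≤ k ≤ n`;
and `A(n,k) = A(n,k-1)` if `2 ≤ n < k`. -/
theorem A_recurrence :
    (∀ k : ℕ, 1 ≤ k → A 1 k = 1) ∧
    (∀ n : ℕ, 1 ≤ n → A n 1 = 1) ∧
    (∀ n k : ℕ, 2 ≤ k → k ≤ n → A n k = A (n - 1) k + A n (k - 1)) ∧
    (∀ n k : ℕ, 2 ≤ n → n < k → A n k = A n (k - 1)) := by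
  refine ⟨A_one, ?_, ?_, ?_⟩
  · intro n hn
    induction n, hn using Nat.le_induction with
    | base => exact A_one 1 le_rfl
    | succ n hn ih =>
      obtain ⟨m, rfl⟩ : ∃ m, n = m + 1 := ⟨n - 1, by omega⟩
      rw [A_step m 0 (by omega), A_zero, ih]
  · intro n k hk hn
    obtain ⟨m, rfl⟩ : ∃ m, n = m + 2 := ⟨n - 2, by omega⟩
    obtain ⟨l, rfl⟩ : ∃ l, k = l + 1 := ⟨k - 1, by omega⟩
    exact A_step m l (by omega)
  · intro n k hn hk
    obtain ⟨m, rfl⟩ : ∃ m, n = m + 1 := ⟨n - 1, by omega⟩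
    rw [A_eq, A_eq]
    congr 1
    ext σ
    simp only [Set.mem_ofPred_eq]
    apply and_congr_right
    intro _
    omega
end
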